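/- Let f be a bounded solution of the capillary problem on the sector Ω that is discontinuous at O, and assume the radial limit Rf(θ) exists for every θ ∈ (−α, α). Suppose f has a decreasing lower fan: there exist α₁ ∈ [−α, α) and η > 0 such that Rf is constant on (−α, α₁] and strictly decreasing on [α₁, α₁ + η] ∩ (−α, α); set β⁻ = α + α₁. Then for every λ ∈ (β⁻, π), A⁻_I(sin(λ − β⁻)/sin λ) + sin(β⁻)/sin λ ≥ 1. -/

import Mathlib

open Real Set Filter MeasureTheory Topology

noncomputable section

/-- The open circular sector with vertex `O = (0,0)`, half-opening angle `α`, radius `δ`. -/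
def sector (α δ : ℝ) : Set (ℝ × ℝ) :=
  {p | ∃ r θ : ℝ, 0 < r ∧ r < δ ∧ -α < θ ∧ θ < α ∧ p = (r * Real.cos θ, r * Real.sin θ)}

/-- The gradient of `f : ℝ × ℝ → ℝ`. -/
def grad (f : ℝ × ℝ → ℝ) (p : ℝ × ℝ) : ℝ × ℝ :=
  (fderiv ℝ f p (1, 0), fderiv ℝ f p (0, 1))

/-- `Tf = ∇f / √(1 + |∇f|²)`. -/
def Tf (f : ℝ × ℝ → ℝ) (p : ℝ × ℝ) : ℝ × ℝ :=
  ((grad f p).1 / Real.sqrt (1 + (grad f p).1 ^ 2 + (grad f p).2 ^ 2),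
   (grad f p).2 / Real.sqrt (1 + (grad f p).1 ^ 2 + (grad f p).2 ^ 2))

/-- `Nf = div (Tf)`. -/
def Nf (f : ℝ × ℝ → ℝ) (p : ℝ × ℝ) : ℝ :=
  fderiv ℝ (fun q => (Tf f q).1) p (1, 0) + fderiv ℝ (fun q => (Tf f q).2) p (0, 1)

/-- Euclidean dot product on `ℝ × ℝ`. -/
def dot (v w : ℝ × ℝ) : ℝ := v.1 * w.1 + v.2 * w.2

/-- `f` is a bounded solution of the capillary problem `Nf = κ f + lam₀` in the sector,
`Tf ⬝ ν = cos γ` on the two open edges, with contact angles `γp, γm : (0,δ) → [0,π]`. -/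
structure IsCapillarySolution (α δ κ lam₀ : ℝ) (γp γm : ℝ → ℝ) (f : ℝ × ℝ → ℝ) : Prop where
  measurable_γp : Measurable γp
  measurable_γm : Measurable γm
  range_γp : ∀ s ∈ Ioo (0:ℝ) δ, γp s ∈ Icc 0 π
  range_γm : ∀ s ∈ Ioo (0:ℝ) δ, γm s ∈ Icc 0 π
  bounded : ∃ M : ℝ, ∀ p ∈ sector α δ, |f p| ≤ M
  smooth : ContDiffOn ℝ 2 f (sector α δ)
  pde : ∀ p ∈ sector α δ, Nf f p = κ * f p + lam₀
  edgeP_smooth : ∀ s ∈ Ioo (0:ℝ) δ, ContDiffAt ℝ 1 f (s * Real.cos α, s * Real.sin α)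
  edgeM_smooth : ∀ s ∈ Ioo (0:ℝ) δ, ContDiffAt ℝ 1 f (s * Real.cos α, -(s * Real.sin α))
  bcP : ∀ s ∈ Ioo (0:ℝ) δ,
    dot (Tf f (s * Real.cos α, s * Real.sin α)) (-Real.sin α, Real.cos α) = Real.cos (γp s)
  bcM : ∀ s ∈ Ioo (0:ℝ) δ,
    dot (Tf f (s * Real.cos α, -(s * Real.sin α))) (-Real.sin α, -Real.cos α) = Real.cos (γm s)

/-- `L` is the radial limit `Rf(θ)` of `f` in direction `θ`. -/
def RadialLimitAt (f : ℝ × ℝ → ℝ) (θ L : ℝ) : Prop :=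
  Tendsto (fun r => f (r * Real.cos θ, r * Real.sin θ)) (𝓝[>] (0:ℝ)) (𝓝 L)

/-- `f` is discontinuous at the corner `O`: `f(x)` has no limit as `Ω ∋ x → O`. -/
def DiscontinuousAtCorner (α δ : ℝ) (f : ℝ × ℝ → ℝ) : Prop :=
  ¬ ∃ L : ℝ, Tendsto f (𝓝[sector α δ] ((0:ℝ), (0:ℝ))) (𝓝 L)

/-- `A_I(b) = liminf_{ε→0⁺} (1/ε) ∫₀^{bε} cos γ(t) dt`. -/
def fanAI (γ : ℝ → ℝ) (b : ℝ) : ℝ :=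
  liminf (fun ε : ℝ => ε⁻¹ * ∫ t in Ioo (0:ℝ) (b * ε), Real.cos (γ t)) (𝓝[>] (0:ℝ))

/-- `A_S(b) = limsup_{ε→0⁺} (1/ε) ∫₀^{bε} cos γ(t) dt`. -/
def fanAS (γ : ℝ → ℝ) (b : ℝ) : ℝ :=
  limsup (fun ε : ℝ => ε⁻¹ * ∫ t in Ioo (0:ℝ) (b * ε), Real.cos (γ t)) (𝓝[>] (0:ℝ))

lemma div_cone (X1 X2 D : ℝ × ℝ → ℝ) (c1 c2 d1 d2 e1 e2 : ℝ → ℝ) (ρ ε a b : ℝ)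
    (hρε : ρ ≤ ε) (hab : a ≤ b)
    (hc1 : ∀ u, HasDerivAt c1 (d1 u) u) (hc2 : ∀ u, HasDerivAt c2 (d2 u) u)
    (hd1 : ∀ u, HasDerivAt d1 (e1 u) u) (hd2 : ∀ u, HasDerivAt d2 (e2 u) u)
    (hX1 : ∀ s ∈ Icc ρ ε, ∀ u ∈ Icc a b, ContinuousAt X1 (s * c1 u, s * c2 u))
    (hX2 : ∀ s ∈ Icc ρ ε, ∀ u ∈ Icc a b, ContinuousAt X2 (s * c1 u, s * c2 u))
    (hD : ∀ s ∈ Icc ρ ε, ∀ u ∈ Icc a b, ContinuousAt D (s * c1 u, s * c2 u))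
    (hX1' : ∀ s ∈ Ioo ρ ε, ∀ u ∈ Ioo a b, DifferentiableAt ℝ X1 (s * c1 u, s * c2 u))
    (hX2' : ∀ s ∈ Ioo ρ ε, ∀ u ∈ Ioo a b, DifferentiableAt ℝ X2 (s * c1 u, s * c2 u))
    (hdiv : ∀ s ∈ Ioo ρ ε, ∀ u ∈ Ioo a b,
      fderiv ℝ X1 (s * c1 u, s * c2 u) (1, 0) + fderiv ℝ X2 (s * c1 u, s * c2 u) (0, 1)
        = D (s * c1 u, s * c2 u)) :
    (∫ s in ρ..ε, ∫ u in a..b, s * (c1 u * d2 u - c2 u * d1 u) * D (s * c1 u, s * c2 u)) =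
      (((∫ s in ρ..ε, (X2 (s * c1 b, s * c2 b) * c1 b - X1 (s * c1 b, s * c2 b) * c2 b)) -
        ∫ s in ρ..ε, (X2 (s * c1 a, s * c2 a) * c1 a - X1 (s * c1 a, s * c2 a) * c2 a)) +
        ∫ u in a..b, ε * (X1 (ε * c1 u, ε * c2 u) * d2 u - X2 (ε * c1 u, ε * c2 u) * d1 u)) -
        ∫ u in a..b, ρ * (X1 (ρ * c1 u, ρ * c2 u) * d2 u - X2 (ρ * c1 u, ρ * c2 u) * d1 u) := by
  classical
  set V1 : ℝ × ℝ → ℝ := fun p => p.1 * (X1 (p.1 * c1 p.2, p.1 * c2 p.2) * d2 p.2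
    - X2 (p.1 * c1 p.2, p.1 * c2 p.2) * d1 p.2) with hV1
  set V2 : ℝ × ℝ → ℝ := fun p => X2 (p.1 * c1 p.2, p.1 * c2 p.2) * c1 p.2
    - X1 (p.1 * c1 p.2, p.1 * c2 p.2) * c2 p.2 with hV2
  set K : ℝ × ℝ → ℝ := fun p => p.1 * (c1 p.2 * d2 p.2 - c2 p.2 * d1 p.2)
    * D (p.1 * c1 p.2, p.1 * c2 p.2) with hK
  have cc1 : Continuous c1 := continuous_iff_continuousAt.2 fun u => (hc1 u).continuousAt
  have cc2 : Continuous c2 := continuous_iff_continuousAt.2 fun u => (hc2 u).continuousAt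
  have cd1 : Continuous d1 := continuous_iff_continuousAt.2 fun u => (hd1 u).continuousAt
  have cd2 : Continuous d2 := continuous_iff_continuousAt.2 fun u => (hd2 u).continuousAt
  have cΦ : Continuous (fun p : ℝ × ℝ => (p.1 * c1 p.2, p.1 * c2 p.2)) := by fun_prop
  have key : ∀ Y : ℝ × ℝ → ℝ, (∀ s ∈ Icc ρ ε, ∀ u ∈ Icc a b, ContinuousAt Y (s * c1 u, s * c2 u)) →
      ContinuousOn (fun p : ℝ × ℝ => Y (p.1 * c1 p.2, p.1 * c2 p.2)) (Icc ρ ε ×ˢ Icc a b) := by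
    intro Y hY p hp
    have h := hY p.1 hp.1 p.2 hp.2
    exact (ContinuousAt.comp (f := fun p : ℝ × ℝ => (p.1 * c1 p.2, p.1 * c2 p.2)) (g := Y) (x := p)
      h cΦ.continuousAt).continuousWithinAt
  have k1 := key X1 hX1
  have k2 := key X2 hX2
  have k3 := key D hD
  have hc : ∀ c : ℝ → ℝ, Continuous c →
      ContinuousOn (fun p : ℝ × ℝ => c p.2) (Icc ρ ε ×ˢ Icc a b) :=
    fun c hc => (hc.comp continuous_snd).continuousOn
  have hf : ContinuousOn (fun p : ℝ × ℝ => p.1) (Icc ρ ε ×ˢ Icc a b) := continuous_fst.continuousOn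
  have CV1 : ContinuousOn V1 (Icc ρ ε ×ˢ Icc a b) :=
    hf.mul ((k1.mul (hc _ cd2)).sub (k2.mul (hc _ cd1)))
  have CV2 : ContinuousOn V2 (Icc ρ ε ×ˢ Icc a b) :=
    (k2.mul (hc _ cc1)).sub (k1.mul (hc _ cc2))
  have CK : ContinuousOn K (Icc ρ ε ×ˢ Icc a b) :=
    (hf.mul (((hc _ cc1).mul (hc _ cd2)).sub ((hc _ cc2).mul (hc _ cd1)))).mul k3
  let B : Set (ℝ × ℝ) := Ioo ρ ε ×ˢ Ioo a b
  have hdiffΦ : ∀ p : ℝ × ℝ, DifferentiableAt ℝ (fun p : ℝ × ℝ => (p.1 * c1 p.2, p.1 * c2 p.2)) p := by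
    intro p
    have h1 : DifferentiableAt ℝ (fun p : ℝ × ℝ => c1 p.2) p :=
      (hc1 p.2).differentiableAt.comp p differentiableAt_snd
    have h2 : DifferentiableAt ℝ (fun p : ℝ × ℝ => c2 p.2) p :=
      (hc2 p.2).differentiableAt.comp p differentiableAt_snd
    exact (differentiableAt_fst.mul h1).prodMk (differentiableAt_fst.mul h2)
  have hDX : ∀ Y : ℝ × ℝ → ℝ, ∀ p : ℝ × ℝ, DifferentiableAt ℝ Y (p.1 * c1 p.2, p.1 * c2 p.2) →
      DifferentiableAt ℝ (fun p : ℝ × ℝ => Y (p.1 * c1 p.2, p.1 * c2 p.2)) p := by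
    intro Y p h
    exact DifferentiableAt.comp (g := Y) (f := fun p : ℝ × ℝ => (p.1 * c1 p.2, p.1 * c2 p.2)) p h (hdiffΦ p)
  have hDc : ∀ (c d : ℝ → ℝ), (∀ u, HasDerivAt c (d u) u) → ∀ p : ℝ × ℝ,
      DifferentiableAt ℝ (fun p : ℝ × ℝ => c p.2) p := by
    intro c d h p
    exact (h p.2).differentiableAt.comp p differentiableAt_snd
  have DV1 : ∀ p ∈ B, DifferentiableAt ℝ V1 p := by
    intro p hp
    have h1 := hDX X1 p (hX1' _ hp.1 _ hp.2)
    have h2 := hDX X2 p (hX2' _ hp.1 _ hp.2)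
    exact differentiableAt_fst.mul ((h1.mul (hDc _ _ hd2 p)).sub (h2.mul (hDc _ _ hd1 p)))
  have DV2 : ∀ p ∈ B, DifferentiableAt ℝ V2 p := by
    intro p hp
    have h1 := hDX X1 p (hX1' _ hp.1 _ hp.2)
    have h2 := hDX X2 p (hX2' _ hp.1 _ hp.2)
    exact (h2.mul (hDc _ _ hc1 p)).sub (h1.mul (hDc _ _ hc2 p))
  have hlin : ∀ (ℓ : ℝ × ℝ →L[ℝ] ℝ) (x y : ℝ), ℓ (x, y) = x * ℓ (1, 0) + y * ℓ (0, 1) := by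
    intro ℓ x y
    have : (x, y) = x • ((1:ℝ), (0:ℝ)) + y • ((0:ℝ), (1:ℝ)) := by simp
    rw [this, map_add, map_smul, map_smul]; simp
  have hdivV : ∀ p ∈ B, fderiv ℝ V1 p (1, 0) + fderiv ℝ V2 p (0, 1) = K p := by
    rintro ⟨s, u⟩ hp
    have a1 := hX1' _ hp.1 _ hp.2
    have a2 := hX2' _ hp.1 _ hp.2
    have hd := hdiv _ hp.1 _ hp.2
    simp only at a1 a2 hd
    have ps : HasDerivAt (fun t : ℝ => (t, u)) ((1:ℝ), (0:ℝ)) s :=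
      (hasDerivAt_id s).prodMk (hasDerivAt_const s u)
    have pu : HasDerivAt (fun t : ℝ => (s, t)) ((0:ℝ), (1:ℝ)) u :=
      (hasDerivAt_const u s).prodMk (hasDerivAt_id u)
    have e1 := (DV1 _ hp).hasFDerivAt.comp_hasDerivAt s ps
    have e2 := (DV2 _ hp).hasFDerivAt.comp_hasDerivAt u pu
    have qs : HasDerivAt (fun t : ℝ => (t * c1 u, t * c2 u)) (1 * c1 u, 1 * c2 u) s :=
      ((hasDerivAt_id s).mul_const _).prodMk ((hasDerivAt_id s).mul_const _)
    have qu : HasDerivAt (fun t : ℝ => (s * c1 t, s * c2 t)) (s * d1 u, s * d2 u) u :=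
      ((hc1 u).const_mul s).prodMk ((hc2 u).const_mul s)
    have x1s := a1.hasFDerivAt.comp_hasDerivAt s qs
    have x2s := a2.hasFDerivAt.comp_hasDerivAt s qs
    have x1u := a1.hasFDerivAt.comp_hasDerivAt u qu
    have x2u := a2.hasFDerivAt.comp_hasDerivAt u qu
    have g1 := (hasDerivAt_id s).mul ((x1s.mul_const (d2 u)).sub (x2s.mul_const (d1 u)))
    have g2 := (x2u.mul (hc1 u)).sub (x1u.mul (hc2 u))
    have r1 := e1.unique g1
    have r2 := e2.unique g2
    rw [r1, r2]
    rw [hlin _ (1 * c1 u), hlin _ (1 * c1 u), hlin _ (s * d1 u), hlin _ (s * d1 u)]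
    simp only [hK, ← hd, Function.comp, id, Pi.sub_apply]
    ring
  have hmain := integral2_divergence_prod_of_hasFDerivAt_off_countable V1 V2
    (fun p => if p ∈ B then fderiv ℝ V1 p else K p • ContinuousLinearMap.fst ℝ ℝ ℝ)
    (fun p => if p ∈ B then fderiv ℝ V2 p else 0) ρ a ε b ∅ countable_empty
    (by rwa [uIcc_of_le hρε, uIcc_of_le hab]) (by rwa [uIcc_of_le hρε, uIcc_of_le hab])
    (by
      intro p hp
      rw [min_eq_left hρε, max_eq_right hρε, min_eq_left hab, max_eq_right hab, sdiff_empty] at hp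
      have hp' : p ∈ B := hp
      simp only [if_pos hp']
      exact (DV1 p hp').hasFDerivAt)
    (by
      intro p hp
      rw [min_eq_left hρε, max_eq_right hρε, min_eq_left hab, max_eq_right hab, sdiff_empty] at hp
      have hp' : p ∈ B := hp
      simp only [if_pos hp']
      exact (DV2 p hp').hasFDerivAt)
  have hfun : ∀ p : ℝ × ℝ, (if p ∈ B then fderiv ℝ V1 p else K p • ContinuousLinearMap.fst ℝ ℝ ℝ) (1, 0)
      + (if p ∈ B then fderiv ℝ V2 p else 0) (0, 1) = K p := by
    intro p
    by_cases hp : p ∈ B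
    · rw [if_pos hp, if_pos hp, hdivV p hp]
    · rw [if_neg hp, if_neg hp]; simp
  simp only [hfun] at hmain
  exact hmain (by
    rw [uIcc_of_le hρε, uIcc_of_le hab]
    exact CK.integrableOn_compact (isCompact_Icc.prod isCompact_Icc))

lemma Tf_sq (f : ℝ × ℝ → ℝ) (p : ℝ × ℝ) : (Tf f p).1 ^ 2 + (Tf f p).2 ^ 2 ≤ 1 := by
  unfold Tf
  have h : 0 < 1 + (grad f p).1 ^ 2 + (grad f p).2 ^ 2 := by positivity
  simp only [div_pow, Real.sq_sqrt h.le]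
  rw [← add_div, div_le_one h]
  linarith

lemma Tf_cross (f : ℝ × ℝ → ℝ) (p : ℝ × ℝ) (x y : ℝ) :
    |(Tf f p).1 * x - (Tf f p).2 * y| ≤ √(x ^ 2 + y ^ 2) := by
  have h := Tf_sq f p
  apply Real.abs_le_sqrt
  nlinarith [sq_nonneg ((Tf f p).1 * y + (Tf f p).2 * x), sq_nonneg x, sq_nonneg y]

lemma Tf_energy (f : ℝ × ℝ → ℝ) (p : ℝ × ℝ) (x y : ℝ) (h1 : x ^ 2 + y ^ 2 = 1) :
    -((grad f p).1 * x + (grad f p).2 * y) - 1 ≤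
      (Tf f p).1 * (grad f p).1 + (Tf f p).2 * (grad f p).2 := by
  unfold Tf
  set g1 := (grad f p).1
  set g2 := (grad f p).2
  have h : 0 < 1 + g1 ^ 2 + g2 ^ 2 := by positivity
  set S := √(1 + g1 ^ 2 + g2 ^ 2) with hS
  have hS2 : S ^ 2 = 1 + g1 ^ 2 + g2 ^ 2 := Real.sq_sqrt h.le
  have hS1 : 1 ≤ S := by
    rw [hS]; apply Real.one_le_sqrt.2; nlinarith [sq_nonneg g1, sq_nonneg g2]
  have hle : |g1 * x + g2 * y| ≤ S := by
    apply Real.abs_le_sqrt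
    nlinarith [sq_nonneg (g1 * y - g2 * x)]
  have e : g1 / S * g1 + g2 / S * g2 = S - 1 / S := by
    field_simp
    linarith
  simp only
  rw [e]
  have : 1 / S ≤ 1 := by rw [div_le_one (by linarith)]; exact hS1
  have := neg_abs_le (g1 * x + g2 * y)
  linarith

lemma grad_contAt {f : ℝ × ℝ → ℝ} {p : ℝ × ℝ} (h : ContDiffAt ℝ 1 f p) (v : ℝ × ℝ) :
    ContinuousAt (fun q => fderiv ℝ f q v) p := by
  have h1 : ContDiffAt ℝ 0 (fderiv ℝ f) p := h.fderiv_right (by norm_num)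
  exact h1.continuousAt.clm_apply continuousAt_const

lemma Tf_contAt {f : ℝ × ℝ → ℝ} {p : ℝ × ℝ} (h : ContDiffAt ℝ 1 f p) :
    ContinuousAt (fun q => (Tf f q).1) p ∧ ContinuousAt (fun q => (Tf f q).2) p := by
  have h1 := grad_contAt h (1, 0)
  have h2 := grad_contAt h (0, 1)
  have h3 : ContinuousAt (fun q => √(1 + (grad f q).1 ^ 2 + (grad f q).2 ^ 2)) p := by
    exact ((continuousAt_const.add (h1.pow 2)).add (h2.pow 2)).sqrt
  have h4 : √(1 + (grad f p).1 ^ 2 + (grad f p).2 ^ 2) ≠ 0 := by positivity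
  exact ⟨h1.div h3 h4, h2.div h3 h4⟩

lemma Tf_diffAt {f : ℝ × ℝ → ℝ} {p : ℝ × ℝ} (h : ContDiffAt ℝ 2 f p) :
    DifferentiableAt ℝ (fun q => (Tf f q).1) p ∧ DifferentiableAt ℝ (fun q => (Tf f q).2) p := by
  have h0 : ContDiffAt ℝ 1 (fderiv ℝ f) p := h.fderiv_right (by norm_num)
  have hd : DifferentiableAt ℝ (fderiv ℝ f) p := h0.differentiableAt (by norm_num)
  have h1 : DifferentiableAt ℝ (fun q => fderiv ℝ f q (1, 0)) p :=
    hd.clm_apply (differentiableAt_const _)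
  have h2 : DifferentiableAt ℝ (fun q => fderiv ℝ f q (0, 1)) p :=
    hd.clm_apply (differentiableAt_const _)
  have h5 : 1 + (grad f p).1 ^ 2 + (grad f p).2 ^ 2 ≠ 0 := by positivity
  have h3 : DifferentiableAt ℝ (fun q => √(1 + (grad f q).1 ^ 2 + (grad f q).2 ^ 2)) p := by
    exact (((differentiableAt_const _).add (h1.pow 2)).add (h2.pow 2)).sqrt h5
  have h4 : √(1 + (grad f p).1 ^ 2 + (grad f p).2 ^ 2) ≠ 0 := by positivity
  simp only [Tf, div_eq_mul_inv]
  exact ⟨h1.mul (h3.inv h4), h2.mul (h3.inv h4)⟩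

lemma sector_eq_image (α δ : ℝ) : sector α δ =
    (fun q : ℝ × ℝ => (q.1 * Real.cos q.2, q.1 * Real.sin q.2)) '' (Ioo 0 δ ×ˢ Ioo (-α) α) := by
  ext p
  constructor
  · rintro ⟨r, θ, h1, h2, h3, h4, rfl⟩
    exact ⟨(r, θ), ⟨⟨h1, h2⟩, ⟨h3, h4⟩⟩, rfl⟩
  · rintro ⟨⟨r, θ⟩, ⟨⟨h1, h2⟩, ⟨h3, h4⟩⟩, rfl⟩
    exact ⟨r, θ, h1, h2, h3, h4, rfl⟩

lemma sector_open (α δ : ℝ) (hα : α ∈ Ioo 0 π) : IsOpen (sector α δ) := by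
  have h := polarCoord.symm.isOpen_image_of_subset_source
    (s := Ioo 0 δ ×ˢ Ioo (-α) α) (isOpen_Ioo.prod isOpen_Ioo) (by
      rintro ⟨r, θ⟩ ⟨⟨h1, h2⟩, ⟨h3, h4⟩⟩
      rw [OpenPartialHomeomorph.symm_source, polarCoord_target]
      exact ⟨h1, by simp only at *; constructor <;> linarith [hα.2]⟩)
  rw [sector_eq_image]
  exact h

lemma cont_param (K : ℝ × ℝ → ℝ) (ρ ε a b : ℝ) (hρε : ρ ≤ ε) (hab : a ≤ b)
    (CK : ContinuousOn K (Icc ρ ε ×ˢ Icc a b)) :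
    IntervalIntegrable (fun s => ∫ u in a..b, K (s, u)) volume ρ ε := by
  have h := CK.integrableOn_compact (μ := volume) (isCompact_Icc.prod isCompact_Icc)
  rw [IntegrableOn, Measure.volume_eq_prod, ← Measure.prod_restrict] at h
  have h2 := h.integral_prod_left
  rw [intervalIntegrable_iff_integrableOn_Icc_of_le hρε]
  refine h2.congr (Eventually.of_forall fun s => ?_)
  simp only
  rw [intervalIntegral.integral_of_le hab, integral_Icc_eq_integral_Ioc]

/-- angular component of `Tf`. -/
def Qf (f : ℝ × ℝ → ℝ) (θ r : ℝ) : ℝ :=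
  (Tf f (r * Real.cos θ, r * Real.sin θ)).2 * Real.cos θ
    - (Tf f (r * Real.cos θ, r * Real.sin θ)).1 * Real.sin θ

lemma Qf_abs (f : ℝ × ℝ → ℝ) (θ r : ℝ) : |Qf f θ r| ≤ 1 := by
  have h := Tf_cross f (r * Real.cos θ, r * Real.sin θ) (Real.sin θ) (Real.cos θ)
  rw [Real.sin_sq_add_cos_sq, Real.sqrt_one, abs_sub_comm] at h
  exact h

lemma energy_est {α δ κ lam₀ : ℝ} {γp γm : ℝ → ℝ} {f : ℝ × ℝ → ℝ} (hα : α ∈ Ioo 0 π)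
    (hsol : IsCapillarySolution α δ κ lam₀ γp γm f) {M C : ℝ}
    (hM : ∀ p ∈ sector α δ, |f p| ≤ M) (hC : ∀ p ∈ sector α δ, |κ * f p + lam₀| ≤ C)
    {θ1 θ2 ρ ε c : ℝ} (h1 : -α < θ1) (h12 : θ1 < θ2) (h2 : θ2 < α) (hρ : 0 < ρ) (hρε : ρ ≤ ε)
    (hε : ε < δ) :
    (∫ r in ρ..ε, (f (r * Real.cos θ1, r * Real.sin θ1) - f (r * Real.cos θ2, r * Real.sin θ2)))
      - ((M + |c|) * C + 1) * (θ2 - θ1) * ε ^ 2 ≤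
    ε * (∫ θ in θ1..θ2, |f (ε * Real.cos θ, ε * Real.sin θ) - c|) + ρ * ((M + |c|) * (θ2 - θ1))
     + (∫ r in ρ..ε, |f (r * Real.cos θ2, r * Real.sin θ2) - c|)
     - ∫ r in ρ..ε, (f (r * Real.cos θ1, r * Real.sin θ1) - c) * Qf f θ1 r := by
  have hmem : ∀ s ∈ Icc ρ ε, ∀ u ∈ Icc θ1 θ2, (s * Real.cos u, s * Real.sin u) ∈ sector α δ :=
    fun s hs u hu => ⟨s, u, by linarith [hs.1], by linarith [hs.2], by linarith [hu.1],
      by linarith [hu.2], rfl⟩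
  have hcd : ∀ p ∈ sector α δ, ContDiffAt ℝ 2 f p := fun p hp =>
    hsol.smooth.contDiffAt ((sector_open α δ hα).mem_nhds hp)
  have hcd1 : ∀ p ∈ sector α δ, ContDiffAt ℝ 1 f p := fun p hp => (hcd p hp).of_le (by norm_num)
  set E : ℝ × ℝ → ℝ := fun q => (Tf f q).1 * (grad f q).1 + (Tf f q).2 * (grad f q).2 with hE
  set D : ℝ × ℝ → ℝ := fun q => (f q - c) * (κ * f q + lam₀) + E q with hD
  have cf : ∀ p ∈ sector α δ, ContinuousAt f p := fun p hp => (hcd p hp).continuousAt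
  have cE : ∀ p ∈ sector α δ, ContinuousAt E p := fun p hp =>
    ((Tf_contAt (hcd1 p hp)).1.mul (grad_contAt (hcd1 p hp) (1, 0))).add
      ((Tf_contAt (hcd1 p hp)).2.mul (grad_contAt (hcd1 p hp) (0, 1)))
  have cD : ∀ p ∈ sector α δ, ContinuousAt D p := fun p hp =>
    (((cf p hp).sub continuousAt_const).mul
      ((continuousAt_const.mul (cf p hp)).add continuousAt_const)).add (cE p hp)
  have cX1 : ∀ p ∈ sector α δ, ContinuousAt (fun q => (f q - c) * (Tf f q).1) p := fun p hp =>
    ((cf p hp).sub continuousAt_const).mul (Tf_contAt (hcd1 p hp)).1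
  have cX2 : ∀ p ∈ sector α δ, ContinuousAt (fun q => (f q - c) * (Tf f q).2) p := fun p hp =>
    ((cf p hp).sub continuousAt_const).mul (Tf_contAt (hcd1 p hp)).2
  have df : ∀ p ∈ sector α δ, DifferentiableAt ℝ f p := fun p hp =>
    (hcd1 p hp).differentiableAt (by norm_num)
  have dX1 : ∀ p ∈ sector α δ, HasFDerivAt (fun q => (f q - c) * (Tf f q).1)
      ((f p - c) • fderiv ℝ (fun q => (Tf f q).1) p + (Tf f p).1 • fderiv ℝ f p) p := fun p hp =>
    ((df p hp).hasFDerivAt.sub_const c).mul (Tf_diffAt (hcd p hp)).1.hasFDerivAt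
  have dX2 : ∀ p ∈ sector α δ, HasFDerivAt (fun q => (f q - c) * (Tf f q).2)
      ((f p - c) • fderiv ℝ (fun q => (Tf f q).2) p + (Tf f p).2 • fderiv ℝ f p) p := fun p hp =>
    ((df p hp).hasFDerivAt.sub_const c).mul (Tf_diffAt (hcd p hp)).2.hasFDerivAt
  have main := div_cone (fun q => (f q - c) * (Tf f q).1) (fun q => (f q - c) * (Tf f q).2) D
    Real.cos Real.sin (fun u => -Real.sin u) Real.cos (fun u => -Real.cos u) (fun u => -Real.sin u)
    ρ ε θ1 θ2 hρε h12.le Real.hasDerivAt_cos Real.hasDerivAt_sin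
    (fun u => (Real.hasDerivAt_sin u).neg) Real.hasDerivAt_cos
    (fun s hs u hu => cX1 _ (hmem s hs u hu)) (fun s hs u hu => cX2 _ (hmem s hs u hu))
    (fun s hs u hu => cD _ (hmem s hs u hu))
    (fun s hs u hu => (dX1 _ (hmem s (Ioo_subset_Icc_self hs) u (Ioo_subset_Icc_self hu))).differentiableAt)
    (fun s hs u hu => (dX2 _ (hmem s (Ioo_subset_Icc_self hs) u (Ioo_subset_Icc_self hu))).differentiableAt)
    (fun s hs u hu => by
      have hm := hmem s (Ioo_subset_Icc_self hs) u (Ioo_subset_Icc_self hu)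
      have hp := hsol.pde _ hm
      rw [(dX1 _ hm).fderiv, (dX2 _ hm).fderiv]
      simp only [hD, hE, ← hp, Nf, grad, add_apply,
        smul_apply, smul_eq_mul]
      ring)
  have hone : ∀ u : ℝ, Real.cos u * Real.cos u - Real.sin u * -Real.sin u = 1 := fun u => by
    nlinarith [Real.sin_sq_add_cos_sq u]
  simp only [hone, mul_one] at main
  -- continuity helpers
  have contr : ∀ Y : ℝ × ℝ → ℝ, (∀ p ∈ sector α δ, ContinuousAt Y p) → ∀ u ∈ Icc θ1 θ2,
      ContinuousOn (fun r : ℝ => Y (r * Real.cos u, r * Real.sin u)) (Icc ρ ε) := by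
    intro Y hY u hu r hr
    have h : Continuous (fun r : ℝ => (r * Real.cos u, r * Real.sin u)) := by fun_prop
    exact (ContinuousAt.comp (f := fun r : ℝ => (r * Real.cos u, r * Real.sin u)) (g := Y) (x := r)
      (hY _ (hmem r hr u hu)) h.continuousAt).continuousWithinAt
  have contθ : ∀ Y : ℝ × ℝ → ℝ, (∀ p ∈ sector α δ, ContinuousAt Y p) → ∀ r ∈ Icc ρ ε,
      ContinuousOn (fun u : ℝ => Y (r * Real.cos u, r * Real.sin u)) (Icc θ1 θ2) := by
    intro Y hY r hr u hu
    have h : Continuous (fun u : ℝ => (r * Real.cos u, r * Real.sin u)) := by fun_prop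
    exact (ContinuousAt.comp (f := fun u : ℝ => (r * Real.cos u, r * Real.sin u)) (g := Y) (x := u)
      (hY _ (hmem r hr u hu)) h.continuousAt).continuousWithinAt
  have contb : ContinuousOn (fun p : ℝ × ℝ => p.1 * D (p.1 * Real.cos p.2, p.1 * Real.sin p.2))
      (Icc ρ ε ×ˢ Icc θ1 θ2) := by
    intro p hp
    have h : Continuous (fun p : ℝ × ℝ => (p.1 * Real.cos p.2, p.1 * Real.sin p.2)) := by fun_prop
    exact (continuousAt_fst.mul (ContinuousAt.comp
      (f := fun p : ℝ × ℝ => (p.1 * Real.cos p.2, p.1 * Real.sin p.2)) (g := D) (x := p)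
      (cD _ (hmem _ hp.1 _ hp.2)) h.continuousAt)).continuousWithinAt
  have hθ1 : θ1 ∈ Icc θ1 θ2 := ⟨le_rfl, h12.le⟩
  have hθ2 : θ2 ∈ Icc θ1 θ2 := ⟨h12.le, le_rfl⟩
  have hερ : ε ∈ Icc ρ ε := ⟨hρε, le_rfl⟩
  have hρρ : ρ ∈ Icc ρ ε := ⟨le_rfl, hρε⟩
  have ii : ∀ g : ℝ → ℝ, ContinuousOn g (Icc ρ ε) → IntervalIntegrable g volume ρ ε := fun g hg =>
    ContinuousOn.intervalIntegrable (by rwa [uIcc_of_le hρε])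
  have jj : ∀ g : ℝ → ℝ, ContinuousOn g (Icc θ1 θ2) → IntervalIntegrable g volume θ1 θ2 := fun g hg =>
    ContinuousOn.intervalIntegrable (by rwa [uIcc_of_le h12.le])
  have hfc : ∀ p ∈ sector α δ, |f p - c| ≤ M + |c| := fun p hp => by
    have := abs_sub (f p) c
    linarith [hM p hp]
  have hM0 : 0 ≤ M + |c| := (abs_nonneg _).trans (hfc _ (hmem _ hερ _ hθ1))
  have hC0 : 0 ≤ C := (abs_nonneg _).trans (hC _ (hmem _ hερ _ hθ1))
  set G := (M + |c|) * C + 1 with hG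
  have hG0 : 0 ≤ G := by positivity
  -- pointwise angular lower bound
  have hlow : ∀ r ∈ Icc ρ ε, (f (r * Real.cos θ1, r * Real.sin θ1) - f (r * Real.cos θ2, r * Real.sin θ2))
      - ε * G * (θ2 - θ1) ≤ ∫ u in θ1..θ2, r * D (r * Real.cos u, r * Real.sin u) := by
    intro r hr
    set dr : ℝ → ℝ := fun u => (grad f (r * Real.cos u, r * Real.sin u)).1 * (r * -Real.sin u) +
      (grad f (r * Real.cos u, r * Real.sin u)).2 * (r * Real.cos u) with hdr
    have hder : ∀ u ∈ Icc θ1 θ2, HasDerivAt (fun u => f (r * Real.cos u, r * Real.sin u)) (dr u) u := by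
      intro u hu
      have q : HasDerivAt (fun t : ℝ => (r * Real.cos t, r * Real.sin t)) (r * -Real.sin u, r * Real.cos u) u :=
        ((Real.hasDerivAt_cos u).const_mul r).prodMk ((Real.hasDerivAt_sin u).const_mul r)
      have := (df _ (hmem r hr u hu)).hasFDerivAt.comp_hasDerivAt u q
      refine this.congr_deriv ?_
      have e : ((r * -Real.sin u, r * Real.cos u) : ℝ × ℝ)
        = (r * -Real.sin u) • ((1:ℝ), (0:ℝ)) + (r * Real.cos u) • ((0:ℝ), (1:ℝ)) := by simp
      rw [e, map_add, map_smul, map_smul]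
      simp only [hdr, grad, smul_eq_mul]
      ring
    have hdc : ContinuousOn dr (Icc θ1 θ2) :=
      ((contθ (fun q => fderiv ℝ f q (1, 0)) (fun p hp => grad_contAt (hcd1 p hp) _) r hr).mul
        (by fun_prop)).add
      ((contθ (fun q => fderiv ℝ f q (0, 1)) (fun p hp => grad_contAt (hcd1 p hp) _) r hr).mul
        (by fun_prop))
    have hftc : ∫ u in θ1..θ2, dr u = f (r * Real.cos θ2, r * Real.sin θ2) - f (r * Real.cos θ1, r * Real.sin θ1) :=
      intervalIntegral.integral_eq_sub_of_hasDerivAt (fun u hu => hder u (by rwa [uIcc_of_le h12.le] at hu))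
        (jj _ hdc)
    have hint : ∫ u in θ1..θ2, (-dr u - ε * G) = (f (r * Real.cos θ1, r * Real.sin θ1) - f (r * Real.cos θ2, r * Real.sin θ2))
      - ε * G * (θ2 - θ1) := by
      have hn : IntervalIntegrable (fun u => -dr u) volume θ1 θ2 := jj _ hdc.neg
      rw [intervalIntegral.integral_sub hn intervalIntegrable_const, intervalIntegral.integral_neg, hftc,
        intervalIntegral.integral_const]
      simp only [smul_eq_mul]; ring
    rw [← hint]
    apply intervalIntegral.integral_mono_on h12.le
    · exact (jj _ hdc.neg).sub (by simp)
    · exact jj _ (continuousOn_const.mul (contθ D cD r hr))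
    · intro u hu
      have hm := hmem r hr u hu
      have en := Tf_energy f (r * Real.cos u, r * Real.sin u) (-Real.sin u) (Real.cos u)
        (by rw [neg_sq, Real.sin_sq_add_cos_sq])
      have hb : |(f (r * Real.cos u, r * Real.sin u) - c) * (κ * f (r * Real.cos u, r * Real.sin u) + lam₀)| ≤ (M + |c|) * C := by
        rw [abs_mul]
        exact mul_le_mul (hfc _ hm) (hC _ hm) (abs_nonneg _) hM0
      have hb' := (abs_le.1 hb).1
      have hr0 : 0 ≤ r := by linarith [hr.1]
      have hDl : -((grad f (r * Real.cos u, r * Real.sin u)).1 * -Real.sin u + (grad f (r * Real.cos u, r * Real.sin u)).2 * Real.cos u) - G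
          ≤ D (r * Real.cos u, r * Real.sin u) := by
        simp only [hD, hE, hG]; linarith
      have := mul_le_mul_of_nonneg_left hDl hr0
      have h5 : r * G ≤ ε * G := mul_le_mul_of_nonneg_right hr.2 hG0
      simp only [hdr]
      linarith
  have hLHS : (∫ r in ρ..ε, (f (r * Real.cos θ1, r * Real.sin θ1) - f (r * Real.cos θ2, r * Real.sin θ2)))
      - G * (θ2 - θ1) * ε ^ 2 ≤ ∫ r in ρ..ε, ∫ u in θ1..θ2, r * D (r * Real.cos u, r * Real.sin u) := by
    have i1 : IntervalIntegrable (fun r => f (r * Real.cos θ1, r * Real.sin θ1) - f (r * Real.cos θ2, r * Real.sin θ2)) volume ρ ε :=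
      ii _ ((contr f cf θ1 hθ1).sub (contr f cf θ2 hθ2))
    have hmono := intervalIntegral.integral_mono_on hρε (i1.sub (intervalIntegrable_const (c := ε * G * (θ2 - θ1))))
      (cont_param _ ρ ε θ1 θ2 hρε h12.le contb) hlow
    simp only at hmono
    rw [intervalIntegral.integral_sub i1 (by simp), intervalIntegral.integral_const] at hmono
    refine le_trans ?_ hmono
    simp only [smul_eq_mul]
    have : 0 ≤ ρ * (ε * G * (θ2 - θ1)) := by
      have : 0 ≤ θ2 - θ1 := by linarith
      have : 0 ≤ ε := by linarith
      positivity
    nlinarith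
  -- right hand side bounds
  have hP : ∀ p u, |(Tf f p).1 * Real.cos u - (Tf f p).2 * -Real.sin u| ≤ 1 := by
    intro p u
    have h := Tf_cross f p (Real.cos u) (-Real.sin u)
    rwa [neg_sq, Real.cos_sq_add_sin_sq, Real.sqrt_one] at h
  have hrhs1 : ∀ r ∈ Icc ρ ε, |∫ u in θ1..θ2, r * ((f (r * Real.cos u, r * Real.sin u) - c) * (Tf f (r * Real.cos u, r * Real.sin u)).1 * Real.cos u
      - (f (r * Real.cos u, r * Real.sin u) - c) * (Tf f (r * Real.cos u, r * Real.sin u)).2 * -Real.sin u)|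
      ≤ r * ∫ u in θ1..θ2, |f (r * Real.cos u, r * Real.sin u) - c| := by
    intro r hr
    rw [intervalIntegral.integral_const_mul, abs_mul, abs_of_nonneg (by linarith [hr.1] : (0:ℝ) ≤ r)]
    apply mul_le_mul_of_nonneg_left _ (by linarith [hr.1] : (0:ℝ) ≤ r)
    have hb := intervalIntegral.norm_integral_le_of_norm_le (μ := volume) h12.le
      (f := fun u => (f (r * Real.cos u, r * Real.sin u) - c) * (Tf f (r * Real.cos u, r * Real.sin u)).1 * Real.cos u
      - (f (r * Real.cos u, r * Real.sin u) - c) * (Tf f (r * Real.cos u, r * Real.sin u)).2 * -Real.sin u)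
      (g := fun u => |f (r * Real.cos u, r * Real.sin u) - c|)
      (Eventually.of_forall fun u _ => by
        rw [mul_assoc, mul_assoc, ← mul_sub, Real.norm_eq_abs, abs_mul]
        exact mul_le_of_le_one_right (abs_nonneg _) (hP _ _))
      (jj _ ((contθ f cf r hr).sub continuousOn_const).abs)
    exact hb
  have hR1 := (abs_le.1 (hrhs1 ε hερ)).2
  have hR2 := (abs_le.1 (hrhs1 ρ hρρ)).1
  have hR3 : (∫ u in θ1..θ2, |f (ρ * Real.cos u, ρ * Real.sin u) - c|) ≤ (M + |c|) * (θ2 - θ1) := by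
    have := intervalIntegral.integral_mono_on h12.le (jj _ ((contθ f cf ρ hρρ).sub continuousOn_const).abs)
      (intervalIntegrable_const (c := M + |c|)) (fun u hu => hfc _ (hmem ρ hρρ u hu))
    rw [intervalIntegral.integral_const, smul_eq_mul] at this
    simp only [Pi.sub_apply] at this
    linarith
  have hR3' := mul_le_mul_of_nonneg_left hR3 hρ.le
  have hR4 : (∫ s in ρ..ε, ((f (s * Real.cos θ2, s * Real.sin θ2) - c) * (Tf f (s * Real.cos θ2, s * Real.sin θ2)).2 * Real.cos θ2
      - (f (s * Real.cos θ2, s * Real.sin θ2) - c) * (Tf f (s * Real.cos θ2, s * Real.sin θ2)).1 * Real.sin θ2))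
      ≤ ∫ r in ρ..ε, |f (r * Real.cos θ2, r * Real.sin θ2) - c| := by
    apply intervalIntegral.integral_mono_on hρε
    · exact ii _ (((contr _ cX2 θ2 hθ2).mul continuousOn_const).sub ((contr _ cX1 θ2 hθ2).mul continuousOn_const))
    · exact ii _ ((contr f cf θ2 hθ2).sub continuousOn_const).abs
    · intro r hr
      rw [mul_assoc, mul_assoc, ← mul_sub]
      refine (le_abs_self _).trans ?_
      rw [abs_mul]
      exact mul_le_of_le_one_right (abs_nonneg _) (Qf_abs f θ2 r)
  have hR5 : (∫ s in ρ..ε, ((f (s * Real.cos θ1, s * Real.sin θ1) - c) * (Tf f (s * Real.cos θ1, s * Real.sin θ1)).2 * Real.cos θ1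
      - (f (s * Real.cos θ1, s * Real.sin θ1) - c) * (Tf f (s * Real.cos θ1, s * Real.sin θ1)).1 * Real.sin θ1))
      = ∫ r in ρ..ε, (f (r * Real.cos θ1, r * Real.sin θ1) - c) * Qf f θ1 r := by
    apply intervalIntegral.integral_congr
    intro r _
    simp only [Qf]; ring
  rw [hR5] at main
  linarith

lemma tri_mem {α δ b θ1 s u : ℝ} (hα : α ∈ Ioo 0 π) (hb : 0 < b) (h1 : -α < θ1) (h2 : θ1 < α)
    (h3 : α + θ1 < π) (hs : 0 < s) (hs1 : s < δ) (hs2 : b * s < δ) (hu : 0 < u) (hu1 : u ≤ 1) :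
    (s * ((1 - u) * (b * Real.cos α) + u * Real.cos θ1),
      s * (-(1 - u) * (b * Real.sin α) + u * Real.sin θ1)) ∈ sector α δ := by
  set β := α + θ1 with hβ
  have hβ0 : 0 < β := by linarith
  have hsβ : 0 < Real.sin β := Real.sin_pos_of_pos_of_lt_pi hβ0 h3
  set x := (1 - u) * b + u * Real.cos β with hx
  set y := u * Real.sin β with hy
  have hy0 : 0 < y := by positivity
  set w : ℂ := ⟨x, y⟩ with hw
  set r := ‖w‖ with hr
  set φ := w.arg with hφ
  have hw0 : w ≠ 0 := by
    intro h
    have : w.im = 0 := by rw [h]; simp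
    exact hy0.ne' this
  have hr0 : 0 < r := norm_pos_iff.2 hw0
  have ex : r * Real.cos φ = x := by
    rw [hφ, Complex.cos_arg hw0]; field_simp; rfl
  have ey : r * Real.sin φ = y := by
    rw [hφ, Complex.sin_arg]; field_simp; rfl
  have hφ1 : 0 < φ := by
    by_contra h
    push Not at h
    have := Real.sin_nonpos_of_nonpos_of_neg_pi_le h (Complex.neg_pi_lt_arg w).le
    nlinarith
  have hφ2 : φ ≤ β := by
    by_contra h
    push Not at h
    have hp : 0 < Real.sin (φ - β) :=
      Real.sin_pos_of_pos_of_lt_pi (by linarith) (by linarith [Complex.arg_le_pi w])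
    have e : r * Real.sin (φ - β) = -((1 - u) * b * Real.sin β) := by
      rw [Real.sin_sub]
      have : r * (Real.sin φ * Real.cos β - Real.cos φ * Real.sin β)
        = (r * Real.sin φ) * Real.cos β - (r * Real.cos φ) * Real.sin β := by ring
      rw [this, ex, ey, hx, hy]; ring
    have : 0 ≤ (1 - u) * b * Real.sin β := by
      have : 0 ≤ 1 - u := by linarith
      positivity
    nlinarith [mul_pos hr0 hp]
  have hr2 : r ^ 2 = x ^ 2 + y ^ 2 := by
    rw [← ex, ← ey]; nlinarith [Real.sin_sq_add_cos_sq φ]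
  have hu' : 0 ≤ 1 - u := by linarith
  have hrle : r ≤ (1 - u) * b + u := by
    apply abs_le_of_sq_le_sq' _ (by positivity) |>.2
    rw [hr2, hx, hy]
    have : 0 ≤ (1 - u) * b * u * (1 - Real.cos β) := by
      have := Real.cos_le_one β
      have : 0 ≤ 1 - Real.cos β := by linarith
      positivity
    have e : ((1 - u) * b + u * Real.cos β) ^ 2 + (u * Real.sin β) ^ 2
        = ((1 - u) * b) ^ 2 + 2 * ((1 - u) * b * u * Real.cos β)
          + u ^ 2 * (Real.sin β ^ 2 + Real.cos β ^ 2) := by ring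
    rw [e, Real.sin_sq_add_cos_sq]
    linarith
  refine ⟨s * r, φ - α, by positivity, ?_, by linarith, by linarith, ?_⟩
  · have h4 := mul_le_mul_of_nonneg_left hrle hs.le
    have h5 : 0 ≤ (1 - u) * (δ - b * s) := mul_nonneg hu' (by linarith)
    have h6 : 0 < u * (δ - s) := mul_pos hu (by linarith)
    nlinarith
  · have c1 : Real.cos θ1 = Real.cos β * Real.cos α + Real.sin β * Real.sin α := by
      rw [← Real.cos_sub, hβ]; congr 1; ring
    have s1 : Real.sin θ1 = Real.sin β * Real.cos α - Real.cos β * Real.sin α := by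
      rw [← Real.sin_sub, hβ]; congr 1; ring
    ext
    · simp only
      rw [Real.cos_sub, c1]
      have : s * r * (Real.cos φ * Real.cos α + Real.sin φ * Real.sin α)
        = s * ((r * Real.cos φ) * Real.cos α + (r * Real.sin φ) * Real.sin α) := by ring
      rw [this, ex, ey, hx, hy]; ring
    · simp only
      rw [Real.sin_sub, s1]
      have : s * r * (Real.sin φ * Real.cos α - Real.cos φ * Real.sin α)
        = s * ((r * Real.sin φ) * Real.cos α - (r * Real.cos φ) * Real.sin α) := by ring
      rw [this, ex, ey, hx, hy]; ring

lemma triangle_est {α δ κ lam₀ : ℝ} {γp γm : ℝ → ℝ} {f : ℝ × ℝ → ℝ} (hα : α ∈ Ioo 0 π)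
    (hsol : IsCapillarySolution α δ κ lam₀ γp γm f) {C : ℝ}
    (hC : ∀ p ∈ sector α δ, |κ * f p + lam₀| ≤ C)
    {θ1 ρ ε b : ℝ} (hb : 0 < b) (h1 : -α < θ1) (h2 : θ1 < α) (h3 : α + θ1 < π)
    (hρ : 0 < ρ) (hρε : ρ ≤ ε) (hε : ε < δ) (hbε : b * ε < δ) :
    -(C * b * ε ^ 2) - (ε + ρ) * √(1 + b ^ 2 - 2 * b * Real.cos (α + θ1))
      ≤ (∫ t in (b * ρ)..(b * ε), Real.cos (γm t)) + ∫ r in ρ..ε, Qf f θ1 r := by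
  have hcd : ∀ p ∈ sector α δ, ContDiffAt ℝ 2 f p := fun p hp =>
    hsol.smooth.contDiffAt ((sector_open α δ hα).mem_nhds hp)
  set c1 : ℝ → ℝ := fun u => (1 - u) * (b * Real.cos α) + u * Real.cos θ1 with hc1
  set c2 : ℝ → ℝ := fun u => -(1 - u) * (b * Real.sin α) + u * Real.sin θ1 with hc2
  set d1 : ℝ := Real.cos θ1 - b * Real.cos α with hd1
  set d2 : ℝ := Real.sin θ1 + b * Real.sin α with hd2
  have hmem : ∀ s ∈ Icc ρ ε, ∀ u ∈ Ioc (0:ℝ) 1, (s * c1 u, s * c2 u) ∈ sector α δ :=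
    fun s hs u hu => tri_mem hα hb h1 h2 h3 (by linarith [hs.1]) (by linarith [hs.2])
      (by nlinarith [hs.2]) hu.1 hu.2
  have hedge : ∀ s : ℝ, (s * c1 0, s * c2 0) = ((b * s) * Real.cos α, -((b * s) * Real.sin α)) := by
    intro s; ext <;> simp only [hc1, hc2] <;> ring
  have hbs : ∀ s ∈ Icc ρ ε, b * s ∈ Ioo 0 δ := fun s hs =>
    ⟨mul_pos hb (by linarith [hs.1]), by nlinarith [hs.2]⟩
  have hcd1 : ∀ s ∈ Icc ρ ε, ∀ u ∈ Icc (0:ℝ) 1, ContDiffAt ℝ 1 f (s * c1 u, s * c2 u) := by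
    intro s hs u hu
    rcases hu.1.eq_or_lt with h | h
    · rw [← h, hedge]
      exact hsol.edgeM_smooth _ (hbs s hs)
    · exact (hcd _ (hmem s hs u ⟨h, hu.2⟩)).of_le (by norm_num)
  have main := div_cone (fun q => (Tf f q).1) (fun q => (Tf f q).2) (fun q => κ * f q + lam₀)
    c1 c2 (fun _ => d1) (fun _ => d2) (fun _ => 0) (fun _ => 0) ρ ε 0 1 hρε zero_le_one
    (fun u => by
      have := (((hasDerivAt_id u).const_sub 1).mul_const (b * Real.cos α)).add
        ((hasDerivAt_id u).mul_const (Real.cos θ1))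
      exact this.congr_deriv (by rw [hd1]; ring))
    (fun u => by
      have := ((((hasDerivAt_id u).const_sub 1).neg).mul_const (b * Real.sin α)).add
        ((hasDerivAt_id u).mul_const (Real.sin θ1))
      exact this.congr_deriv (by rw [hd2]; ring))
    (fun u => hasDerivAt_const u _) (fun u => hasDerivAt_const u _)
    (fun s hs u hu => (Tf_contAt (hcd1 s hs u hu)).1)
    (fun s hs u hu => (Tf_contAt (hcd1 s hs u hu)).2)
    (fun s hs u hu => (continuousAt_const.mul (hcd1 s hs u hu).continuousAt).add continuousAt_const)
    (fun s hs u hu => (Tf_diffAt (hcd _ (hmem s (Ioo_subset_Icc_self hs) u (Ioo_subset_Ioc_self hu)))).1)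
    (fun s hs u hu => (Tf_diffAt (hcd _ (hmem s (Ioo_subset_Icc_self hs) u (Ioo_subset_Ioc_self hu)))).2)
    (fun s hs u hu => hsol.pde _ (hmem s (Ioo_subset_Icc_self hs) u (Ioo_subset_Ioc_self hu)))
  set L := √(1 + b ^ 2 - 2 * b * Real.cos (α + θ1)) with hL
  have hLd : √(d2 ^ 2 + d1 ^ 2) = L := by
    rw [hL, hd1, hd2, Real.cos_add]
    congr 1
    nlinarith [Real.sin_sq_add_cos_sq α, Real.sin_sq_add_cos_sq θ1]
  have hε0 : 0 < ε := by linarith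
  have hC0 : 0 ≤ C := (abs_nonneg _).trans (hC _ (hmem ε ⟨hρε, le_rfl⟩ 1 ⟨one_pos, le_rfl⟩))
  have hflux : ∀ s : ℝ, 0 < s → |∫ u in (0:ℝ)..1, s * ((Tf f (s * c1 u, s * c2 u)).1 * d2 - (Tf f (s * c1 u, s * c2 u)).2 * d1)| ≤ s * L := by
    intro s hs
    have := intervalIntegral.norm_integral_le_of_norm_le_const (a := (0:ℝ)) (b := 1) (C := s * L)
      (f := fun u => s * ((Tf f (s * c1 u, s * c2 u)).1 * d2 - (Tf f (s * c1 u, s * c2 u)).2 * d1))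
      (fun u _ => by
        rw [Real.norm_eq_abs, abs_mul, abs_of_pos hs, ← hLd]
        exact mul_le_mul_of_nonneg_left (Tf_cross f _ d2 d1) hs.le)
    simpa using this
  have hcross : ∀ u, |c1 u * d2 - c2 u * d1| ≤ b := by
    intro u
    have : c1 u * d2 - c2 u * d1 = b * Real.sin (α + θ1) := by
      simp only [hc1, hc2, hd1, hd2]
      rw [Real.sin_add]; ring
    rw [this, abs_mul, abs_of_pos hb]
    exact mul_le_of_le_one_right hb.le (Real.abs_sin_le_one _)
  have hvol : |∫ s in ρ..ε, ∫ u in (0:ℝ)..1, s * (c1 u * d2 - c2 u * d1) * (κ * f (s * c1 u, s * c2 u) + lam₀)| ≤ C * b * ε ^ 2 := by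
    have hin : ∀ s ∈ uIoc ρ ε, ‖∫ u in (0:ℝ)..1, s * (c1 u * d2 - c2 u * d1) * (κ * f (s * c1 u, s * c2 u) + lam₀)‖ ≤ ε * b * C := by
      intro s hs
      rw [uIoc_of_le hρε] at hs
      have := intervalIntegral.norm_integral_le_of_norm_le_const (a := (0:ℝ)) (b := 1) (C := ε * b * C)
        (f := fun u => s * (c1 u * d2 - c2 u * d1) * (κ * f (s * c1 u, s * c2 u) + lam₀))
        (fun u hu => by
          rw [uIoc_of_le zero_le_one] at hu
          rw [Real.norm_eq_abs, abs_mul, abs_mul, abs_of_pos (by linarith [hs.1] : 0 < s)]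
          exact mul_le_mul (mul_le_mul hs.2 (hcross u) (abs_nonneg _) hε0.le)
            (hC _ (hmem s (Ioc_subset_Icc_self hs) u hu)) (abs_nonneg _) (by positivity))
      simpa using this
    have := intervalIntegral.norm_integral_le_of_norm_le_const hin
    rw [Real.norm_eq_abs, abs_of_nonneg (by linarith : 0 ≤ ε - ρ)] at this
    refine this.trans ?_
    have : 0 ≤ ε * b * C := by positivity
    nlinarith
  have hA : (∫ s in ρ..ε, ((Tf f (s * c1 1, s * c2 1)).2 * c1 1 - (Tf f (s * c1 1, s * c2 1)).1 * c2 1)) = ∫ r in ρ..ε, Qf f θ1 r := by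
    have e1 : c1 1 = Real.cos θ1 := by simp [hc1]
    have e2 : c2 1 = Real.sin θ1 := by simp [hc2]
    rw [e1, e2]
    rfl
  have hB : (∫ s in ρ..ε, ((Tf f (s * c1 0, s * c2 0)).2 * c1 0 - (Tf f (s * c1 0, s * c2 0)).1 * c2 0)) = -∫ t in (b * ρ)..(b * ε), Real.cos (γm t) := by
    rw [← intervalIntegral.mul_integral_comp_mul_left, ← intervalIntegral.integral_const_mul,
      ← intervalIntegral.integral_neg]
    apply intervalIntegral.integral_congr
    intro s hs
    rw [uIcc_of_le hρε] at hs
    have hbc := hsol.bcM _ (hbs s hs)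
    simp only
    rw [hedge, ← hbc]
    simp only [dot, hc1, hc2]
    ring
  rw [hA, hB] at main
  have i1 := (abs_le.1 (hflux ε hε0)).2
  have i2 := (abs_le.1 (hflux ρ hρ)).1
  have i3 := (abs_le.1 hvol).1
  linarith

lemma flux_ev {α δ κ lam₀ : ℝ} {γp γm : ℝ → ℝ} {f : ℝ × ℝ → ℝ} {R : ℝ → ℝ} (hα : α ∈ Ioo 0 π)
    (hδ : 0 < δ)
    (hsol : IsCapillarySolution α δ κ lam₀ γp γm f) {M C : ℝ}
    (hM : ∀ p ∈ sector α δ, |f p| ≤ M) (hC : ∀ p ∈ sector α δ, |κ * f p + lam₀| ≤ C)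
    (hR : ∀ θ ∈ Ioo (-α) α, RadialLimitAt f θ (R θ))
    {θ1 θ2 τ : ℝ} (h1 : -α < θ1) (h12 : θ1 < θ2) (h2 : θ2 < α) (hτ : 0 < τ)
    (hanti : StrictAntiOn R (Icc θ1 θ2)) :
    ∀ᶠ ε in 𝓝[>] (0:ℝ), ε * (1 - (θ2 - θ1) - τ) ≤ -∫ r in (ε ^ 2)..ε, Qf f θ1 r := by
  have hθ1 : θ1 ∈ Icc θ1 θ2 := ⟨le_rfl, h12.le⟩
  have hθ2 : θ2 ∈ Icc θ1 θ2 := ⟨h12.le, le_rfl⟩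
  set D := R θ1 - R θ2 with hD
  have hD0 : 0 < D := by have := hanti hθ1 hθ2 h12; rw [hD]; linarith
  set Δ := θ2 - θ1 with hΔ
  have hΔ0 : 0 < Δ := by rw [hΔ]; linarith
  set c := R θ2 with hc
  set τ' := D * τ / 6 with hτ'
  have hτ0 : 0 < τ' := by positivity
  have hcd : ∀ p ∈ sector α δ, ContDiffAt ℝ 2 f p := fun p hp =>
    hsol.smooth.contDiffAt ((sector_open α δ hα).mem_nhds hp)
  have hmem : ∀ r ∈ Ioo 0 δ, ∀ u ∈ Icc θ1 θ2, (r * Real.cos u, r * Real.sin u) ∈ sector α δ :=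
    fun s hs u hu => ⟨s, u, hs.1, hs.2, by linarith [hu.1], by linarith [hu.2], rfl⟩
  -- dominated convergence
  have hdct : Tendsto (fun ε : ℝ => ∫ θ in θ1..θ2, |f (ε * Real.cos θ, ε * Real.sin θ) - c|)
      (𝓝[>] 0) (𝓝 (∫ θ in θ1..θ2, |R θ - c|)) := by
    apply intervalIntegral.tendsto_integral_filter_of_dominated_convergence (fun _ => M + |c|)
    · filter_upwards [Ioo_mem_nhdsGT hδ] with ε hε
      rw [uIoc_of_le h12.le]
      refine ContinuousOn.aestronglyMeasurable ?_ measurableSet_Ioc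
      intro u hu
      have h : Continuous (fun u : ℝ => (ε * Real.cos u, ε * Real.sin u)) := by fun_prop
      have := (ContinuousAt.comp (f := fun u : ℝ => (ε * Real.cos u, ε * Real.sin u)) (g := f) (x := u)
        (hcd _ (hmem ε hε u (Ioc_subset_Icc_self hu))).continuousAt h.continuousAt)
      exact ((this.sub continuousAt_const).abs).continuousWithinAt
    · filter_upwards [Ioo_mem_nhdsGT hδ] with ε hε
      refine Eventually.of_forall fun u hu => ?_
      rw [uIoc_of_le h12.le] at hu
      rw [Real.norm_eq_abs, abs_abs]
      have := abs_sub (f (ε * Real.cos u, ε * Real.sin u)) c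
      linarith [hM _ (hmem ε hε u (Ioc_subset_Icc_self hu))]
    · exact intervalIntegrable_const
    · refine Eventually.of_forall fun u hu => ?_
      rw [uIoc_of_le h12.le] at hu
      exact ((hR u ⟨by linarith [hu.1], by linarith [hu.2]⟩).sub_const c).abs
  have hlim : (∫ θ in θ1..θ2, |R θ - c|) ≤ D * Δ := by
    have := intervalIntegral.norm_integral_le_of_norm_le_const (a := θ1) (b := θ2) (C := D)
      (f := fun θ => |R θ - c|) (fun u hu => by
        rw [uIoc_of_le h12.le] at hu
        have hu' := Ioc_subset_Icc_self hu
        have a1 := hanti.antitoneOn hθ1 hu' hu'.1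
        have a2 := hanti.antitoneOn hu' hθ2 hu'.2
        rw [Real.norm_eq_abs, abs_abs, abs_of_nonneg (by linarith)]
        linarith)
    rw [abs_of_pos (by linarith : 0 < θ2 - θ1)] at this
    exact (le_abs_self _).trans this
  have ev1 : ∀ᶠ ε in 𝓝[>] (0:ℝ), (∫ θ in θ1..θ2, |f (ε * Real.cos θ, ε * Real.sin θ) - c|) ≤ D * Δ + τ' := by
    filter_upwards [hdct.eventually (gt_mem_nhds (show _ < D * Δ + τ' by linarith))] with ε h using le_of_lt h
  have rad : ∀ θ ∈ Icc θ1 θ2, ∃ r₀ > 0, ∀ r ∈ Ioo 0 r₀, |f (r * Real.cos θ, r * Real.sin θ) - R θ| ≤ τ' := by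
    intro θ hθ
    have := (hR θ ⟨by linarith [hθ.1], by linarith [hθ.2]⟩).eventually (Metric.closedBall_mem_nhds _ hτ0)
    obtain ⟨r₀, hr₀, h⟩ := mem_nhdsGT_iff_exists_Ioo_subset.1 this
    exact ⟨r₀, hr₀, fun r hr => by simpa [Real.dist_eq] using h hr⟩
  obtain ⟨r1, hr1, H1⟩ := rad θ1 hθ1
  obtain ⟨r2, hr2, H2⟩ := rad θ2 hθ2
  set G := (M + |c|) * C + 1 with hG
  set Z := D + G * Δ + (M + |c|) * Δ with hZ
  have hZ0 : 0 < |Z| + 1 := by positivity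
  filter_upwards [ev1, Ioo_mem_nhdsGT hδ, Ioo_mem_nhdsGT hr1, Ioo_mem_nhdsGT hr2,
    Ioo_mem_nhdsGT one_pos, Ioo_mem_nhdsGT (show 0 < τ' / (|Z| + 1) by positivity)]
    with ε e1 e2 e3 e4 e5 e6
  have hε := e2.1
  have hρ : 0 < ε ^ 2 := by positivity
  have hρε : ε ^ 2 ≤ ε := by nlinarith [e5.2]
  have est := energy_est (c := c) hα hsol hM hC h1 h12 h2 hρ hρε e2.2
  have contr : ∀ Y : ℝ × ℝ → ℝ, (∀ p ∈ sector α δ, ContinuousAt Y p) → ∀ u ∈ Icc θ1 θ2,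
      ContinuousOn (fun r : ℝ => Y (r * Real.cos u, r * Real.sin u)) (Icc (ε ^ 2) ε) := by
    intro Y hY u hu r hr
    have h : Continuous (fun r : ℝ => (r * Real.cos u, r * Real.sin u)) := by fun_prop
    exact (ContinuousAt.comp (f := fun r : ℝ => (r * Real.cos u, r * Real.sin u)) (g := Y) (x := r)
      (hY _ (hmem r ⟨by linarith [hr.1], by linarith [hr.2, e2.2]⟩ u hu)) h.continuousAt).continuousWithinAt
  have cf := contr f (fun p hp => (hcd p hp).continuousAt)
  have cT1 := contr _ (fun p hp => (Tf_contAt ((hcd p hp).of_le (by norm_num))).1) θ1 hθ1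
  have cT2 := contr _ (fun p hp => (Tf_contAt ((hcd p hp).of_le (by norm_num))).2) θ1 hθ1
  have cQ : ContinuousOn (Qf f θ1) (Icc (ε ^ 2) ε) :=
    (cT2.mul continuousOn_const).sub (cT1.mul continuousOn_const)
  have ii : ∀ g : ℝ → ℝ, ContinuousOn g (Icc (ε ^ 2) ε) → IntervalIntegrable g volume (ε ^ 2) ε := fun g hg =>
    ContinuousOn.intervalIntegrable (by rwa [uIcc_of_le hρε])
  have B1 : ∀ r ∈ Icc (ε ^ 2) ε, |f (r * Real.cos θ1, r * Real.sin θ1) - R θ1| ≤ τ' :=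
    fun r hr => H1 r ⟨by linarith [hr.1], by linarith [hr.2, e3.2]⟩
  have B2 : ∀ r ∈ Icc (ε ^ 2) ε, |f (r * Real.cos θ2, r * Real.sin θ2) - R θ2| ≤ τ' :=
    fun r hr => H2 r ⟨by linarith [hr.1], by linarith [hr.2, e4.2]⟩
  have I1 : (ε - ε ^ 2) * (D - 2 * τ') ≤ ∫ r in (ε ^ 2)..ε, (f (r * Real.cos θ1, r * Real.sin θ1) - f (r * Real.cos θ2, r * Real.sin θ2)) := by
    have i : IntervalIntegrable (fun r => f (r * Real.cos θ1, r * Real.sin θ1) - f (r * Real.cos θ2, r * Real.sin θ2)) volume (ε ^ 2) ε :=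
      ii _ ((cf θ1 hθ1).sub (cf θ2 hθ2))
    have := intervalIntegral.integral_mono_on hρε (intervalIntegrable_const (c := D - 2 * τ')) i
      (fun r hr => by
        have b1 := (abs_le.1 (B1 r hr)).1
        have b2 := (abs_le.1 (B2 r hr)).2
        linarith)
    rwa [intervalIntegral.integral_const, smul_eq_mul] at this
  have I2 : (∫ r in (ε ^ 2)..ε, |f (r * Real.cos θ2, r * Real.sin θ2) - c|) ≤ (ε - ε ^ 2) * τ' := by
    have i : IntervalIntegrable (fun r => |f (r * Real.cos θ2, r * Real.sin θ2) - c|) volume (ε ^ 2) ε :=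
      ii _ ((cf θ2 hθ2).sub continuousOn_const).abs
    have := intervalIntegral.integral_mono_on hρε i (intervalIntegrable_const (c := τ')) B2
    rwa [intervalIntegral.integral_const, smul_eq_mul] at this
  have I3 : D * (∫ r in (ε ^ 2)..ε, Qf f θ1 r) - (ε - ε ^ 2) * τ' ≤
      ∫ r in (ε ^ 2)..ε, (f (r * Real.cos θ1, r * Real.sin θ1) - c) * Qf f θ1 r := by
    have j : IntervalIntegrable (fun r => D * Qf f θ1 r) volume (ε ^ 2) ε :=
      ii _ (continuousOn_const.mul cQ)
    have i : IntervalIntegrable (fun r => (f (r * Real.cos θ1, r * Real.sin θ1) - c) * Qf f θ1 r) volume (ε ^ 2) ε :=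
      ii _ (((cf θ1 hθ1).sub continuousOn_const).mul cQ)
    have := intervalIntegral.integral_mono_on hρε (j.sub (intervalIntegrable_const (c := τ'))) i
      (fun r hr => by
        have hb : |(f (r * Real.cos θ1, r * Real.sin θ1) - R θ1) * Qf f θ1 r| ≤ τ' * 1 := by
          rw [abs_mul]
          exact mul_le_mul (B1 r hr) (Qf_abs _ _ _) (abs_nonneg _) hτ0.le
        have := (abs_le.1 hb).1
        have e : (f (r * Real.cos θ1, r * Real.sin θ1) - c) * Qf f θ1 r
          = (f (r * Real.cos θ1, r * Real.sin θ1) - R θ1) * Qf f θ1 r + D * Qf f θ1 r := by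
          rw [hD]; ring
        rw [e]
        linarith)
    rwa [intervalIntegral.integral_sub j (by simp), intervalIntegral.integral_const,
      intervalIntegral.integral_const_mul, smul_eq_mul] at this
  have I4 := mul_le_mul_of_nonneg_left e1 hε.le
  have I5 : ε * Z ≤ τ' := by
    have h := (lt_div_iff₀ hZ0).1 e6.2
    nlinarith [le_abs_self Z]
  have I6 := mul_le_mul_of_nonneg_left I5 hε.le
  set J := ∫ r in (ε ^ 2)..ε, Qf f θ1 r with hJ
  have hfin : D * (ε * (1 - Δ - τ)) ≤ D * (-J) := by
    have e7 : D * (ε * (1 - Δ - τ)) = ε * (D - D * Δ - 6 * τ') := by rw [hτ']; ring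
    rw [e7]
    have : 0 ≤ ε ^ 2 * τ' := by positivity
    have hZε : ε * (ε * Z) = ε ^ 2 * D + G * Δ * ε ^ 2 + ε ^ 2 * ((M + |c|) * Δ) := by rw [hZ]; ring
    nlinarith
  exact le_of_mul_le_mul_left hfin hD0

/-- Lower bound for a decreasing lower side fan: if `Rf` is constant on
`(−α, α₁]` and strictly decreasing on `[α₁, α₁ + η] ∩ (−α, α)`, then with `β⁻ = α + α₁`,
for every `λ ∈ (β⁻, π)` one has
`A⁻_I(sin(λ−β⁻)/sin λ) + sin β⁻ / sin λ ≥ 1`. -/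
theorem lower_fan_decreasing_bound
    (α δ κ lam₀ : ℝ) (γp γm : ℝ → ℝ) (f : ℝ × ℝ → ℝ) (R : ℝ → ℝ)
    (hα : α ∈ Ioo 0 π) (hδ : 0 < δ)
    (hsol : IsCapillarySolution α δ κ lam₀ γp γm f)
    (hdisc : DiscontinuousAtCorner α δ f)
    (hR : ∀ θ ∈ Ioo (-α) α, RadialLimitAt f θ (R θ))
    (α₁ η : ℝ) (hα₁ : α₁ ∈ Ico (-α) α) (hη : 0 < η)
    (hconst : ∃ c : ℝ, ∀ θ ∈ Ioc (-α) α₁, R θ = c)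
    (hanti : StrictAntiOn R (Icc α₁ (α₁ + η) ∩ Ioo (-α) α)) :
    ∀ lam ∈ Ioo (α + α₁) π,
      1 ≤ fanAI γm (Real.sin (lam - (α + α₁)) / Real.sin lam) +
        Real.sin (α + α₁) / Real.sin lam := by
  intro lam hlam
  obtain ⟨M, hM⟩ := hsol.bounded
  have hC : ∀ p ∈ sector α δ, |κ * f p + lam₀| ≤ |κ| * M + |lam₀| := by
    intro p hp
    refine (abs_add_le _ _).trans ?_
    rw [abs_mul]
    have := mul_le_mul_of_nonneg_left (hM p hp) (abs_nonneg κ)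
    linarith
  set C := |κ| * M + |lam₀| with hCdef
  set β := α + α₁ with hβ
  have hβ0 : 0 ≤ β := by linarith [hα₁.1]
  have hl0 : 0 < lam := by linarith [hlam.1]
  have hsl : 0 < Real.sin lam := Real.sin_pos_of_pos_of_lt_pi hl0 hlam.2
  have hslb : 0 < Real.sin (lam - β) :=
    Real.sin_pos_of_pos_of_lt_pi (by linarith [hlam.1]) (by linarith [hlam.2])
  set b := Real.sin (lam - β) / Real.sin lam with hb
  have hb0 : 0 < b := by positivity
  have hsβ : 0 ≤ Real.sin β := Real.sin_nonneg_of_nonneg_of_le_pi hβ0 (by linarith [hlam.1, hlam.2])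
  have hL : √(1 + b ^ 2 - 2 * b * Real.cos (α + α₁)) = Real.sin β / Real.sin lam := by
    rw [← hβ]
    have e : 1 + b ^ 2 - 2 * b * Real.cos β = (Real.sin β / Real.sin lam) ^ 2 := by
      rw [hb]
      field_simp
      rw [Real.sin_sub]
      have h1 := Real.sin_sq_add_cos_sq lam
      have h2 := Real.sin_sq_add_cos_sq β
      have h3 : Real.cos lam ^ 2 = 1 - Real.sin lam ^ 2 := by linarith
      have h4 : Real.cos β ^ 2 = 1 - Real.sin β ^ 2 := by linarith
      ring_nf
      rw [h3, h4]
      ring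
    rw [e, Real.sqrt_sq (by positivity)]
  suffices h : ∀ τ > 0, 1 - Real.sin β / Real.sin lam - τ ≤ fanAI γm b by
    have := le_of_forall_sub_le h
    linarith
  intro τ hτ
  have hcosint : ∀ x y : ℝ, IntervalIntegrable (fun t => Real.cos (γm t)) volume x y := by
    intro x y
    refine (intervalIntegrable_const (c := (1:ℝ))).mono_fun' ?_ ?_
    · exact (Real.measurable_cos.comp hsol.measurable_γm).aestronglyMeasurable
    · exact Eventually.of_forall fun t => by
        simpa using Real.abs_cos_le_one _
  have hcosb : ∀ x y : ℝ, |∫ t in x..y, Real.cos (γm t)| ≤ |y - x| := by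
    intro x y
    have := intervalIntegral.norm_integral_le_of_norm_le_const (a := x) (b := y) (C := 1)
      (f := fun t => Real.cos (γm t)) (fun t _ => by
        rw [Real.norm_eq_abs]; exact Real.abs_cos_le_one _)
    simpa using this
  have hIoo : ∀ ε : ℝ, 0 < ε → (∫ t in Ioo (0:ℝ) (b * ε), Real.cos (γm t)) = ∫ t in (0:ℝ)..(b * ε), Real.cos (γm t) := by
    intro ε hε
    rw [intervalIntegral.integral_of_le (by positivity), integral_Ioc_eq_integral_Ioo]
  -- choice of the angles
  have hcont : Tendsto (fun θ => √(1 + b ^ 2 - 2 * b * Real.cos (α + θ))) (𝓝[>] α₁)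
      (𝓝 (Real.sin β / Real.sin lam)) := by
    rw [← hL]
    have : Continuous (fun θ => √(1 + b ^ 2 - 2 * b * Real.cos (α + θ))) := by fun_prop
    exact this.continuousAt.tendsto.mono_left nhdsWithin_le_nhds
  have v1 := hcont.eventually (gt_mem_nhds
    (show Real.sin β / Real.sin lam < Real.sin β / Real.sin lam + τ / 4 by linarith))
  have v2 : ∀ᶠ θ in 𝓝[>] α₁, θ ∈ Ioo α₁ α := Ioo_mem_nhdsGT hα₁.2
  have v3 : ∀ᶠ θ in 𝓝[>] α₁, θ ∈ Ioo α₁ (α₁ + η) := Ioo_mem_nhdsGT (by linarith)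
  have v4 : ∀ᶠ θ in 𝓝[>] α₁, θ ∈ Ioo α₁ (π - α) :=
    Ioo_mem_nhdsGT (by linarith [hlam.1, hlam.2])
  obtain ⟨θ1, t1, t2, t3, t4⟩ := (v1.and (v2.and (v3.and v4))).exists
  set θ2 := min (θ1 + τ / 4) (min ((θ1 + α) / 2) ((θ1 + (α₁ + η)) / 2)) with hθ2
  have q1 : θ1 < θ2 := by
    refine lt_min (by linarith) (lt_min (by linarith [t2.2]) (by linarith [t3.2]))
  have q2 : θ2 ≤ θ1 + τ / 4 := min_le_left _ _
  have q3 : θ2 ≤ (θ1 + α) / 2 := (min_le_right _ _).trans (min_le_left _ _)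
  have q4 : θ2 ≤ (θ1 + (α₁ + η)) / 2 := (min_le_right _ _).trans (min_le_right _ _)
  have p1 : -α < θ1 := by linarith [hα₁.1, t2.1]
  have p2 : θ2 < α := by linarith [t2.2]
  have hflux := flux_ev hα hδ hsol hM hC hR p1 q1 p2 (show 0 < τ / 4 by linarith)
    (hanti.mono (fun θ hθ => ⟨⟨by linarith [hθ.1, t2.1], by linarith [hθ.2, t3.2]⟩,
      ⟨by linarith [hθ.1], by linarith [hθ.2]⟩⟩))
  set L := √(1 + b ^ 2 - 2 * b * Real.cos (α + θ1)) with hLdef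
  have hL0 : 0 ≤ L := Real.sqrt_nonneg _
  set Z := C * b + L + b with hZ
  have hZ0 : 0 < |Z| + 1 := by positivity
  unfold fanAI
  refine le_liminf_of_le ?_ ?_
  · -- coboundedness
    refine Filter.IsBoundedUnder.isCoboundedUnder_ge ⟨b, ?_⟩
    rw [eventually_map]
    filter_upwards [self_mem_nhdsWithin] with ε hε
    have hε : 0 < ε := hε
    rw [hIoo ε hε]
    have := (le_abs_self _).trans (hcosb 0 (b * ε))
    rw [sub_zero, abs_of_pos (by positivity)] at this
    rw [inv_mul_le_iff₀ hε]
    linarith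
  · filter_upwards [hflux, Ioo_mem_nhdsGT hδ, Ioo_mem_nhdsGT (show 0 < δ / b by positivity),
      Ioo_mem_nhdsGT one_pos, Ioo_mem_nhdsGT (show 0 < (τ / 4) / (|Z| + 1) by positivity)]
      with ε f1 f2 f3 f4 f5
    have hε := f2.1
    have hρ : 0 < ε ^ 2 := by positivity
    have hρε : ε ^ 2 ≤ ε := by nlinarith [f4.2]
    have hbε : b * ε < δ := by have := (lt_div_iff₀ hb0).1 f3.2; linarith
    have tri := triangle_est hα hsol hC hb0 p1 t2.2 (by linarith [t4.2]) hρ hρε f2.2 hbε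
    rw [hIoo ε hε, le_inv_mul_iff₀ hε,
      ← intervalIntegral.integral_add_adjacent_intervals (hcosint 0 (b * ε ^ 2)) (hcosint (b * ε ^ 2) (b * ε))]
    have s1 := (abs_le.1 (hcosb 0 (b * ε ^ 2))).1
    rw [sub_zero, abs_of_pos (by positivity)] at s1
    have I5 : ε * Z ≤ τ / 4 := by
      have h := (lt_div_iff₀ hZ0).1 f5.2
      nlinarith [le_abs_self Z]
    have I6 := mul_le_mul_of_nonneg_left I5 hε.le
    have hZε : ε * (ε * Z) = C * b * ε ^ 2 + ε ^ 2 * L + b * ε ^ 2 := by rw [hZ]; ring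
    have I7 := mul_le_mul_of_nonneg_left t1.le hε.le
    have I8 := mul_le_mul_of_nonneg_left q2 hε.le
    nlinarith
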